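/- Let M be a Riemannian three-manifold carrying a unit Killing field ξ and let p ∈ M. Then M admits a totally geodesic surface passing through p which is everywhere orthogonal to ξ if and only if, in a neighborhood of p, M has a Riemannian product structure Σ × I of a surface Σ with an interval I in which ξ is tangent to the factor I. -/

import Mathlib

noncomputable section
open Real Set

/-- Points of the coordinate chart `ℝⁿ`. -/
abbrev Pt (n : ℕ) := Fin n → ℝ

/-- The `i`-th standard coordinate vector. -/
def stdb (n : ℕ) (i : Fin n) : Pt n := Pi.single i 1

/-- Riemannian metric data in coordinates: a field of symmetric bilinear forms. -/
abbrev Met (n : ℕ) := Pt n → Fin n → Fin n → ℝ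

/-- The inner product of the vectors `v`, `w` at the point `x`, with respect to `g`. -/
def minner {n : ℕ} (g : Met n) (x v w : Pt n) : ℝ := ∑ i, ∑ j, g x i j * v i * w j

/-- `g` is a smooth Riemannian metric on `U`. -/
def IsMetricOn {n : ℕ} (U : Set (Pt n)) (g : Met n) : Prop :=
  (∀ i j, ContDiffOn ℝ (⊤ : ℕ∞) (fun x => g x i j) U) ∧
  (∀ x i j, g x i j = g x j i) ∧
  (∀ x ∈ U, ∀ v : Pt n, v ≠ 0 → 0 < minner g x v v)

/-- The inverse metric `g^{kl}`. -/
def ginv {n : ℕ} (g : Met n) (x : Pt n) : Fin n → Fin n → ℝ :=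
  fun k l => (Matrix.of (g x))⁻¹ k l

/-- The Christoffel symbols `Γᵏᵢⱼ` of the Levi-Civita connection of `g`. -/
def christoffel {n : ℕ} (g : Met n) (x : Pt n) (k i j : Fin n) : ℝ :=
  (1/2) * ∑ l, ginv g x k l *
    (fderiv ℝ (fun y => g y j l) x (stdb n i) + fderiv ℝ (fun y => g y i l) x (stdb n j)
      - fderiv ℝ (fun y => g y i j) x (stdb n l))

/-- The covariant derivative (Levi-Civita connection of `g`) of the vector field `Y`
at the point `x` in the direction `v`. -/
def covD {n : ℕ} (g : Met n) (Y : Pt n → Pt n) (x v : Pt n) : Pt n :=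
  fun k => fderiv ℝ (fun y => Y y k) x v + ∑ i, ∑ j, christoffel g x k i j * v i * Y x j

/-- `X` is a Killing field of `g` on `U`. -/
def IsKillingOn {n : ℕ} (U : Set (Pt n)) (g : Met n) (X : Pt n → Pt n) : Prop :=
  ∀ x ∈ U, ∀ v w : Pt n,
    minner g x (covD g X x v) w + minner g x (covD g X x w) v = 0

/-- `X` has unit length on `U`. -/
def IsUnitOn {n : ℕ} (U : Set (Pt n)) (g : Met n) (X : Pt n → Pt n) : Prop :=
  ∀ x ∈ U, minner g x (X x) (X x) = 1

/-- The Lie bracket `[X,Y]` of two vector fields, in coordinates. -/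
def lieB {n : ℕ} (X Y : Pt n → Pt n) (x : Pt n) : Pt n :=
  fun k => fderiv ℝ (fun y => Y y k) x (X x) - fderiv ℝ (fun y => X y k) x (Y x)

/-- A parametrized hypersurface `F : V → ℝ^{n+1}` with a chosen unit normal field `N`. -/
structure Hyp (n : ℕ) where
  V : Set (Pt n)
  F : Pt n → Pt (n+1)
  N : Pt n → Pt (n+1)

/-- The ambient covariant derivative, along the map `F`, of the ambient-vector-valued
field `W` defined on the parameter domain, in the coordinate direction `v`. -/
def covAlong {n : ℕ} (g : Met (n+1)) (F W : Pt n → Pt (n+1)) (u v : Pt n) : Pt (n+1) :=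
  fun k => fderiv ℝ (fun y => W y k) u v +
    ∑ i, ∑ j, christoffel g (F u) k i j * fderiv ℝ F u v i * W u j

/-- `S` is a smooth immersed hypersurface inside the chart `U`, with unit normal `N`. -/
def Hyp.IsRegular {n : ℕ} (S : Hyp n) (U : Set (Pt (n+1))) (g : Met (n+1)) : Prop :=
  IsOpen S.V ∧ ContDiffOn ℝ (⊤ : ℕ∞) S.F S.V ∧ (∀ u ∈ S.V, S.F u ∈ U) ∧
  (∀ u ∈ S.V, LinearIndependent ℝ (fun a : Fin n => fderiv ℝ S.F u (stdb n a))) ∧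
  ContDiffOn ℝ (⊤ : ℕ∞) S.N S.V ∧
  (∀ u ∈ S.V, minner g (S.F u) (S.N u) (S.N u) = 1) ∧
  (∀ u ∈ S.V, ∀ a : Fin n, minner g (S.F u) (S.N u) (fderiv ℝ S.F u (stdb n a)) = 0)

/-- `S` is totally geodesic: the shape operator `X ↦ -∇̃_X N` vanishes. -/
def Hyp.TotallyGeodesic {n : ℕ} (S : Hyp n) (g : Met (n+1)) : Prop :=
  ∀ u ∈ S.V, ∀ a : Fin n, covAlong g S.F S.N u (stdb n a) = 0

/-- `S` is totally umbilical: the shape operator `X ↦ -∇̃_X N` is pointwise a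
multiple of the identity. -/
def Hyp.TotallyUmbilical {n : ℕ} (S : Hyp n) (g : Met (n+1)) : Prop :=
  ∃ lam : Pt n → ℝ, ∀ u ∈ S.V, ∀ a : Fin n,
    covAlong g S.F S.N u (stdb n a) = lam u • fderiv ℝ S.F u (stdb n a)

/-- Projection onto the first `n` coordinates. -/
def projBase {n : ℕ} (x : Pt (n+1)) : Pt n := fun i => x i.castSucc

/-- The product metric of `g₀` with the Euclidean line (last coordinate). -/
def prodMet {n : ℕ} (g₀ : Met n) : Met (n+1) := fun x i j =>
  Fin.lastCases (Fin.lastCases 1 (fun _ => 0) j)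
    (fun i' => Fin.lastCases 0 (fun j' => g₀ (projBase x) i' j') j) i

/-- The coordinate domain of a product `𝕄 × I`. -/
def prodDom {n : ℕ} (U₀ : Set (Pt n)) (I : Set ℝ) : Set (Pt (n+1)) :=
  {x | projBase x ∈ U₀ ∧ x (Fin.last n) ∈ I}

/-- The unit vertical field `ξ` of a product `𝕄 × I`. -/
def vert (n : ℕ) : Pt (n+1) → Pt (n+1) := fun _ => stdb (n+1) (Fin.last n)

/-- The pullback of the metric `g` under the map `Φ`. -/
def pullMet {n : ℕ} (g : Met n) (Φ : Pt n → Pt n) : Met n :=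
  fun x i j => minner g (Φ x) (fderiv ℝ Φ x (stdb n i)) (fderiv ℝ Φ x (stdb n j))

/-- `g` has, on the coordinate domain `W`, the shape `dt² + f(t)² g_M` of a warped
product of an interval (the `0`-th coordinate) with an `n`-dimensional manifold. -/
def IsWarpedForm {n : ℕ} (g : Met (n+1)) (W : Set (Pt (n+1))) : Prop :=
  ∃ f : ℝ → ℝ, ContDiff ℝ (⊤ : ℕ∞) f ∧ (∀ t, 0 < f t) ∧
    ∀ x ∈ W, g x 0 0 = 1 ∧
      (∀ i : Fin (n+1), i ≠ 0 → g x 0 i = 0 ∧ g x i 0 = 0) ∧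
      (∀ i j : Fin (n+1), i ≠ 0 → j ≠ 0 →
        fderiv ℝ (fun y => g y i j / f (y 0) ^ 2) x (stdb (n+1) 0) = 0)

/-- The Riemannian manifold `(U₀, g₀)` has, in a neighborhood of `p`, the structure of a
warped product of an interval of the Euclidean line with an `n`-dimensional manifold:
there is a diffeomorphism `Φ` from a coordinate domain `W` onto a neighborhood of `p`
pulling `g₀` back to a warped-product metric. -/
def LocallyWarpedAt {n : ℕ} (U₀ : Set (Pt (n+1))) (g₀ : Met (n+1)) (p : Pt (n+1)) : Prop :=
  ∃ (W : Set (Pt (n+1))) (Φ Ψ : Pt (n+1) → Pt (n+1)),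
    IsOpen W ∧ ContDiffOn ℝ (⊤ : ℕ∞) Φ W ∧ MapsTo Φ W U₀ ∧
    IsOpen (Φ '' W) ∧ p ∈ Φ '' W ∧
    ContDiffOn ℝ (⊤ : ℕ∞) Ψ (Φ '' W) ∧ (∀ w ∈ W, Ψ (Φ w) = w) ∧
    IsWarpedForm (pullMet g₀ Φ) W

/-- The Levi-Civita symbol on three indices. -/
def lcSymb (i j k : Fin 3) : ℝ :=
  ((j.val : ℝ) - (i.val : ℝ)) * ((k.val : ℝ) - (i.val : ℝ)) * ((k.val : ℝ) - (j.val : ℝ)) / 2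

/-- The cross product of `v` and `w` at `x`, with respect to the metric `g` and the
orientation of the chart. -/
def crossG (g : Met 3) (x v w : Pt 3) : Pt 3 :=
  fun k => Real.sqrt (Matrix.det (Matrix.of (g x))) *
    ∑ l, ginv g x k l * ∑ i, ∑ j, lcSymb l i j * v i * w j

/-- The components `Rˡᵢⱼₖ` of the Riemann curvature tensor
(`R(∂ᵢ,∂ⱼ)∂ₖ = Rˡᵢⱼₖ ∂ₗ`, with `R(X,Y) = ∇_X∇_Y - ∇_Y∇_X - ∇_{[X,Y]}`). -/
def riem {n : ℕ} (g : Met n) (x : Pt n) (l i j k : Fin n) : ℝ :=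
  fderiv ℝ (fun y => christoffel g y l j k) x (stdb n i)
  - fderiv ℝ (fun y => christoffel g y l i k) x (stdb n j)
  + ∑ m, (christoffel g x l i m * christoffel g x m j k
      - christoffel g x l j m * christoffel g x m i k)

/-- The curvature operator `R(v,w)z` at `x`. -/
def riemVec {n : ℕ} (g : Met n) (x v w z : Pt n) : Pt n :=
  fun l => ∑ i, ∑ j, ∑ k, riem g x l i j k * v i * w j * z k

/-- `g` has constant sectional curvature `c` on `W`. -/
def HasConstCurv {n : ℕ} (W : Set (Pt n)) (g : Met n) (c : ℝ) : Prop :=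
  ∀ x ∈ W, ∀ v w : Pt n,
    minner g x (riemVec g x v w w) v
      = c * (minner g x v v * minner g x w w - (minner g x v w) ^ 2)

/-- The Ricci tensor of `g`. -/
def ricci {n : ℕ} (g : Met n) (x : Pt n) (j k : Fin n) : ℝ := ∑ i, riem g x i i j k

/-- The scalar curvature of `g`. -/
def scal {n : ℕ} (g : Met n) (x : Pt n) : ℝ := ∑ j, ∑ k, ginv g x j k * ricci g x j k

/-- The metric `dx² + sin²θ(x) dy² + cos²θ(x) dz²` on a three-dimensional chart. -/
def tgMet (θ : ℝ → ℝ) : Met 3 := fun x i j =>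
  if i = j then
    (if i = 0 then 1 else if i = 1 then (Real.sin (θ (x 0))) ^ 2 else (Real.cos (θ (x 0))) ^ 2)
  else 0

/-- The warped product metric `dt² + f(t)² g₀` (interval coordinate first). -/
def warpMet {n : ℕ} (f : ℝ → ℝ) (g₀ : Met n) : Met (n+1) := fun x i j =>
  Fin.cases (Fin.cases 1 (fun _ => 0) j)
    (fun i' => Fin.cases 0 (fun j' => f (x 0) ^ 2 * g₀ (Fin.tail x) i' j') j) i

/-- The coordinate domain of a warped product `I ×_f 𝕄` (interval coordinate first). -/
def warpDom {n : ℕ} (I : Set ℝ) (U₀ : Set (Pt n)) : Set (Pt (n+1)) :=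
  {x | x 0 ∈ I ∧ Fin.tail x ∈ U₀}

/-- The covariant acceleration of a curve `γ`, whose vanishing defines geodesics. -/
def curveAccel {n : ℕ} (g : Met n) (γ : ℝ → Pt n) (s : ℝ) : Pt n :=
  fun k => deriv (fun t => deriv (fun r => γ r k) t) s +
    ∑ i, ∑ j, christoffel g (γ s) k i j * deriv (fun r => γ r i) s * deriv (fun r => γ r j) s

/-- The velocity of a curve. -/
def vel {n : ℕ} (γ : ℝ → Pt n) (s : ℝ) : Pt n := fun k => deriv (fun r => γ r k) s

universe u

/-- Pointwise evaluation of a continuous family of operators on a continuous family of vectors. -/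
def evalOpCLM (K E F : Type*) [TopologicalSpace K] [CompactSpace K] [NormedAddCommGroup E]
    [NormedSpace ℝ E] [NormedAddCommGroup F] [NormedSpace ℝ F] :
    C(K, E →L[ℝ] F) →L[ℝ] C(K, E) →L[ℝ] C(K, F) :=
  LinearMap.mkContinuous₂
    (LinearMap.mk₂ ℝ (fun (A : C(K, E →L[ℝ] F)) (h : C(K, E)) =>
        (⟨fun t => A t (h t), by fun_prop⟩ : C(K, F)))
      (fun A B h => by ext t; simp) (fun c A h => by ext t; simp)
      (fun A h k => by ext t; simp) (fun c A h => by ext t; simp)) 1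
    (fun A h => by
      refine (ContinuousMap.norm_le _ (by positivity)).2 fun t => ?_
      rw [one_mul]
      exact (A t).le_of_opNorm_le_of_le (A.norm_coe_le_norm t) (h.norm_coe_le_norm t))

/-- Composition with a smooth map is a smooth operation on spaces of continuous functions. -/
theorem contDiff_continuousMap_comp_nat {K : Type*} [TopologicalSpace K] [CompactSpace K]
    {E : Type u} [NormedAddCommGroup E] [NormedSpace ℝ E] (n : ℕ) :
    ∀ {F : Type u} [NormedAddCommGroup F] [NormedSpace ℝ F] (f : C(E, F)), ContDiff ℝ n f →
      ContDiff ℝ n (fun γ : C(K, E) => f.comp γ) := by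
  induction n with
  | zero =>
    intro F _ _ f _
    exact contDiff_zero.2 f.continuous_postcomp
  | succ n ih =>
    intro F _ _ f hf
    have hf' : ContDiff ℝ (n + 1) f := by exact_mod_cast hf
    obtain ⟨f', hf'n, hff'⟩ := contDiff_succ_iff_hasFDerivAt.1 hf'
    let D : C(E, E →L[ℝ] F) := ⟨f', hf'n.continuous⟩
    have hE : ContDiff ℝ n (evalOpCLM K E F) := ContinuousLinearMap.contDiff _
    have h : ContDiff ℝ (n + 1) (fun γ : C(K, E) => f.comp γ) := by
      refine contDiff_succ_iff_hasFDerivAt.2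
        ⟨fun γ => evalOpCLM K E F (D.comp γ), hE.comp (ih D hf'n), fun γ => ?_⟩
      rw [hasFDerivAt_iff_isLittleO, Asymptotics.isLittleO_iff]
      intro c hc
      have hcont : Continuous (fun η : C(K, E) => D.comp η) := D.continuous_postcomp
      obtain ⟨δ, hδ, hD⟩ :=
        (Metric.continuous_iff (α := C(K, E)) (β := C(K, E →L[ℝ] F))).1 hcont γ c hc
      filter_upwards [Metric.ball_mem_nhds γ hδ] with η hη
      refine (ContinuousMap.norm_le _ (by positivity)).2 fun t => ?_
      have hseg : ∀ x ∈ segment ℝ (γ t) (η t), ‖f' x - f' (γ t)‖ ≤ c := by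
        intro x hx
        obtain ⟨s, hs, rfl⟩ := (segment_eq_image' ℝ (γ t) (η t)) ▸ hx
        have hlt : dist (γ + s • (η - γ)) γ < δ := by
          rw [dist_eq_norm, add_sub_cancel_left, norm_smul, Real.norm_of_nonneg hs.1]
          exact (mul_le_of_le_one_left (norm_nonneg _) hs.2).trans_lt
            (by rwa [← dist_eq_norm])
        have := (ContinuousMap.dist_lt_iff hc).1 (hD _ hlt) t
        rw [dist_eq_norm] at this
        exact this.le
      calc ‖(f.comp η - f.comp γ - evalOpCLM K E F (D.comp γ) (η - γ)) t‖
          = ‖f (η t) - f (γ t) - f' (γ t) (η t - γ t)‖ := rfl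
        _ ≤ c * ‖η t - γ t‖ :=
          (convex_segment _ _).norm_image_sub_le_of_norm_hasFDerivWithin_le'
            (fun x _ => (hff' x).hasFDerivWithinAt) hseg (left_mem_segment _ _ _)
            (right_mem_segment _ _ _)
        _ ≤ c * ‖η - γ‖ := by gcongr; exact (η - γ).norm_coe_le_norm t
    exact_mod_cast h

theorem contDiff_continuousMap_comp {K : Type*} [TopologicalSpace K] [CompactSpace K]
    {E F : Type u} [NormedAddCommGroup E] [NormedSpace ℝ E] [NormedAddCommGroup F]
    [NormedSpace ℝ F] (f : C(E, F)) (hf : ContDiff ℝ (⊤ : ℕ∞) f) :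
    ContDiff ℝ (⊤ : ℕ∞) (fun γ : C(K, E) => f.comp γ) :=
  contDiff_infty.2 fun n => contDiff_continuousMap_comp_nat n f (contDiff_infty.1 hf n)

/-- The inverse function theorem for maps that are smooth on an open set, with an inverse that
is smooth on its whole domain. -/
theorem exists_openPartialHomeomorph_contDiffOn_symm {E F : Type*} [NormedAddCommGroup E]
    [NormedSpace ℝ E] [CompleteSpace E] [NormedAddCommGroup F] [NormedSpace ℝ F]
    {f : E → F} {s : Set E} (hs : IsOpen s)
    (hf : ContDiffOn ℝ (⊤ : ℕ∞) f s) {a : E} (ha : a ∈ s) (f' : E ≃L[ℝ] F)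
    (hf' : HasFDerivAt f (f' : E →L[ℝ] F) a) :
    ∃ e : OpenPartialHomeomorph E F, a ∈ e.source ∧ e.source ⊆ s ∧ (∀ x, e x = f x) ∧
      ContDiffOn ℝ (⊤ : ℕ∞) e.symm e.target := by
  have hfa : ∀ x ∈ s, ContDiffAt ℝ (⊤ : ℕ∞) f x := fun x hx => hf.contDiffAt (hs.mem_nhds hx)
  let O := s ∩ fderiv ℝ f ⁻¹' range ((↑) : (E ≃L[ℝ] F) → E →L[ℝ] F)
  have hO : IsOpen O :=
    (hf.continuousOn_fderiv_of_isOpen hs (by simp)).isOpen_inter_preimage hs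
      ContinuousLinearEquiv.isOpen
  let e₀ := (hfa a ha).toOpenPartialHomeomorph f hf' (by simp)
  refine ⟨e₀.restrOpen O hO, ?_, ?_, fun x => rfl, ?_⟩
  · rw [OpenPartialHomeomorph.restrOpen_source]
    exact ⟨(hfa a ha).mem_toOpenPartialHomeomorph_source hf' (by simp), ha,
      ⟨f', hf'.fderiv.symm⟩⟩
  · rw [OpenPartialHomeomorph.restrOpen_source]
    exact fun x hx => hx.2.1
  · intro y hy
    have hx := (e₀.restrOpen O hO).map_target hy
    rw [OpenPartialHomeomorph.restrOpen_source] at hx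
    obtain ⟨-, hxs, f'', hf''⟩ := hx
    refine ((e₀.restrOpen O hO).contDiffAt_symm (f₀' := f'') hy ?_
      (hfa _ hxs)).contDiffWithinAt
    rw [hf'']
    exact ((hfa _ hxs).differentiableAt (by simp)).hasFDerivAt

/-- The indefinite integral from `0`, as an operator on continuous functions on `[-1, 1]`. -/
def primitiveCLM (E : Type*) [NormedAddCommGroup E] [NormedSpace ℝ E] :
    C(Icc (-1 : ℝ) 1, E) →L[ℝ] C(Icc (-1 : ℝ) 1, E) :=
  LinearMap.mkContinuous
    { toFun := fun u => ⟨fun t => ∫ τ in (0 : ℝ)..t, IccExtend (by norm_num) u τ,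
        (intervalIntegral.continuous_primitive
          (fun _ _ => (u.continuous.Icc_extend' (h := by norm_num)).intervalIntegrable _ _) 0).comp
          continuous_subtype_val⟩
      map_add' := fun u v => by
        ext t
        exact intervalIntegral.integral_add
          ((u.continuous.Icc_extend' (h := by norm_num)).intervalIntegrable _ _)
          ((v.continuous.Icc_extend' (h := by norm_num)).intervalIntegrable _ _)
      map_smul' := fun c u => by
        ext t
        exact intervalIntegral.integral_smul _ _ } 1
    (fun u => by
      refine (ContinuousMap.norm_le _ (by positivity)).2 fun t => ?_
      refine (intervalIntegral.norm_integral_le_of_norm_le_const (C := ‖u‖)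
        fun τ _ => u.norm_coe_le_norm _).trans ?_
      rw [mul_comm, sub_zero]
      gcongr
      exact abs_le.2 t.2)

theorem hasDerivAt_primitiveCLM {E : Type*} [NormedAddCommGroup E] [NormedSpace ℝ E]
    [CompleteSpace E] (u : C(Icc (-1 : ℝ) 1, E)) {t : ℝ} (ht : t ∈ Ioo (-1 : ℝ) 1) :
    HasDerivAt (fun τ => IccExtend (by norm_num) (primitiveCLM E u) τ)
      (IccExtend (by norm_num) u t) t := by
  have hc := u.continuous.Icc_extend' (h := (by norm_num : (-1 : ℝ) ≤ 1))
  have := intervalIntegral.integral_hasDerivAt_right (hc.intervalIntegrable 0 t)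
    (hc.stronglyMeasurableAtFilter _ _) hc.continuousAt
  refine this.congr_of_eventuallyEq ?_
  filter_upwards [Ioo_mem_nhds ht.1 ht.2] with τ hτ
  rw [IccExtend_of_mem _ _ (Ioo_subset_Icc_self hτ)]
  rfl

/-- The integral equation of a smooth autonomous vector field `f`, with the time scaling `s` as a
parameter: solutions `γ` on `[-1, 1]` depend smoothly on `s` and on the initial value. -/
theorem exists_contDiffOn_integral_equation {E : Type u} [NormedAddCommGroup E] [NormedSpace ℝ E]
    [CompleteSpace E] (f : C(E, E)) (hf : ContDiff ℝ (⊤ : ℕ∞) f) (x₀ : E) :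
    ∃ (T : Set (ℝ × E)) (Γ : ℝ × E → C(Icc (-1 : ℝ) 1, E)), IsOpen T ∧ (0, x₀) ∈ T ∧
      ContDiffOn ℝ (⊤ : ℕ∞) Γ T ∧
      ∀ q ∈ T, Γ q = ContinuousMap.const _ q.2 + q.1 • primitiveCLM E (f.comp (Γ q)) := by
  let X := C(Icc (-1 : ℝ) 1, E)
  let P : X → X := fun γ => primitiveCLM E (f.comp γ)
  have hJ : ContDiff ℝ (⊤ : ℕ∞) (primitiveCLM E) := ContinuousLinearMap.contDiff _
  have hP : ContDiff ℝ (⊤ : ℕ∞) P := hJ.comp (contDiff_continuousMap_comp f hf)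
  let H : ℝ × X → ℝ × X := fun z => (z.1, z.2 - z.1 • P z.2)
  have hH : ContDiff ℝ (⊤ : ℕ∞) H :=
    contDiff_fst.prodMk (contDiff_snd.sub (contDiff_fst.smul (hP.comp contDiff_snd)))
  let c : E →L[ℝ] X := LinearMap.mkContinuous
    { toFun := fun x => ContinuousMap.const _ x
      map_add' := fun _ _ => rfl
      map_smul' := fun _ _ => rfl } 1
    (fun x => (ContinuousMap.norm_le _ (by positivity)).2 fun t => (one_mul ‖x‖).ge)
  let A : (ℝ × X) ≃L[ℝ] (ℝ × X) :=
    ContinuousLinearEquiv.skewProd (.refl ℝ ℝ) (.refl ℝ X)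
      (ContinuousLinearMap.toSpanSingleton ℝ (-P (c x₀)))
  have hA : HasFDerivAt H (A : ℝ × X →L[ℝ] ℝ × X) (0, c x₀) := by
    have hPd : HasFDerivAt P (fderiv ℝ P (c x₀)) ((0, c x₀) : ℝ × X).2 :=
      (hP.differentiable (by simp) _).hasFDerivAt
    have h := (hasFDerivAt_fst (𝕜 := ℝ) (p := ((0, c x₀) : ℝ × X))).prodMk
      ((hasFDerivAt_snd (𝕜 := ℝ) (p := ((0, c x₀) : ℝ × X))).sub
        ((hasFDerivAt_fst (𝕜 := ℝ) (p := ((0, c x₀) : ℝ × X))).smul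
          (hPd.comp ((0, c x₀) : ℝ × X) hasFDerivAt_snd)))
    refine h.congr_fderiv ?_
    ext z <;> simp [A]
  obtain ⟨e, he0, -, heH, hes⟩ :=
    exists_openPartialHomeomorph_contDiffOn_symm isOpen_univ hH.contDiffOn (mem_univ _) A hA
  let ι : ℝ × E → ℝ × X := fun q => (q.1, c q.2)
  have hι : ContDiff ℝ (⊤ : ℕ∞) ι := contDiff_fst.prodMk (c.contDiff.comp contDiff_snd)
  refine ⟨ι ⁻¹' e.target, fun q => (e.symm (ι q)).2, e.open_target.preimage hι.continuous, ?_,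
    contDiff_snd.comp_contDiffOn (hes.comp hι.contDiffOn fun q hq => hq), ?_⟩
  · have : ι (0, x₀) = e (0, c x₀) := by rw [heH]; simp [ι, H]
    rw [mem_preimage, this]
    exact e.map_source he0
  · intro q hq
    have h := e.right_inv hq
    rw [heH] at h
    have h1 : (e.symm (ι q)).1 = q.1 := congrArg Prod.fst h
    have h2 : (e.symm (ι q)).2 - (e.symm (ι q)).1 • P (e.symm (ι q)).2 = c q.2 :=
      congrArg Prod.snd h
    rw [h1] at h2
    exact sub_eq_iff_eq_add.1 h2

/-- The local flow of a smooth Lipschitz vector field is jointly smooth. -/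
theorem exists_contDiffOn_flow {E : Type u} [NormedAddCommGroup E] [NormedSpace ℝ E]
    [CompleteSpace E] {f : E → E} (hf : ContDiff ℝ (⊤ : ℕ∞) f) {K : NNReal}
    (hK : LipschitzWith K f) (x₀ : E) :
    ∃ (O : Set (ℝ × E)) (φ : ℝ × E → E), IsOpen O ∧ (0, x₀) ∈ O ∧
      ContDiffOn ℝ (⊤ : ℕ∞) φ O ∧ (∀ x, (0, x) ∈ O → φ (0, x) = x) ∧
      ∀ q ∈ O, HasDerivAt (fun s => φ (s, q.2)) (f (φ q)) q.1 := by
  obtain ⟨T, Γ, hT, h0T, hΓ, hΓe⟩ :=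
    exists_contDiffOn_integral_equation ⟨f, hf.continuous⟩ hf x₀
  have h1 : (1 : ℝ) ∈ Icc (-1 : ℝ) 1 := by norm_num
  have hle : (-1 : ℝ) ≤ 1 := by norm_num
  obtain ⟨ε, hε, hεT⟩ := Metric.isOpen_iff.1 hT _ h0T
  have hmem : ∀ s x, |s| < ε → x ∈ Metric.ball x₀ ε → (s, x) ∈ T := fun s x hs hx => by
    refine hεT ?_
    rw [← ball_prod_same]
    exact ⟨by simpa using hs, hx⟩
  let γ : ℝ → E → ℝ → E := fun s x => IccExtend hle (Γ (s, x))
  have hγc : ∀ s x, Continuous (γ s x) := fun s x => (Γ (s, x)).continuous.Icc_extend'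
  have hγ : ∀ s x, (s, x) ∈ T → ∀ t ∈ Ioo (-1 : ℝ) 1,
      HasDerivAt (γ s x) (s • f (γ s x t)) t := by
    intro s x hs t ht
    refine (((hasDerivAt_primitiveCLM ((⟨f, hf.continuous⟩ : C(E, E)).comp (Γ (s, x)))
      ht).const_smul s).const_add x).congr_of_eventuallyEq ?_
    refine Filter.Eventually.of_forall fun τ => ?_
    have := congrArg (fun u : C(Icc (-1 : ℝ) 1, E) => u (projIcc _ _ hle τ)) (hΓe _ hs)
    exact this
  have hγ0 : ∀ s x, (s, x) ∈ T → γ s x 0 = x := by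
    intro s x hs
    have h0 : (0 : ℝ) ∈ Icc (-1 : ℝ) 1 := by norm_num
    have := congrArg (fun u : C(Icc (-1 : ℝ) 1, E) => u ⟨0, h0⟩) (hΓe _ hs)
    simp only [γ]
    rw [IccExtend_of_mem _ _ h0, this]
    simp [primitiveCLM]
  let φ : ℝ × E → E := fun q => Γ q ⟨1, h1⟩
  have hη : 0 < ε / 2 := by positivity
  have hηT : ∀ x ∈ Metric.ball x₀ ε, (ε / 2, x) ∈ T := fun x hx =>
    hmem _ _ (by rw [abs_of_pos hη]; linarith) hx
  have hφ : ∀ s x, |s| < ε / 2 → x ∈ Metric.ball x₀ ε → φ (s, x) = γ (ε / 2) x (s / (ε / 2)) := by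
    intro s x hs hx
    have hsT := hmem s x (by linarith) hx
    have hbd : ∀ τ ∈ Ioo (-1 : ℝ) 1, s / (ε / 2) * τ ∈ Ioo (-1 : ℝ) 1 := by
      intro τ hτ
      rw [mem_Ioo, ← abs_lt, abs_mul, abs_div, abs_of_pos hη]
      exact mul_lt_one_of_nonneg_of_lt_one_left (by positivity) ((div_lt_one hη).2 hs)
        (abs_lt.2 hτ).le
    have heq : EqOn (γ s x) (fun τ => γ (ε / 2) x (s / (ε / 2) * τ)) (Ioo (-1) 1) := by
      refine ODE_solution_unique_of_mem_Ioo (v := fun _ y => s • f y) (s := fun _ => univ)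
        (t₀ := 0) (K := ‖s‖₊ * K) (fun t _ => ?_) (by norm_num)
        (fun t ht => ⟨hγ s x hsT t ht, mem_univ _⟩) (fun t ht => ⟨?_, mem_univ _⟩) ?_
      · exact ((lipschitzWith_smul s).comp hK).lipschitzOnWith
      · have := (hγ _ x (hηT x hx) _ (hbd t ht)).scomp t ((hasDerivAt_id t).const_mul (s / (ε / 2)))
        rwa [smul_smul, mul_one, div_mul_cancel₀ _ hη.ne'] at this
      · simp [hγ0 s x hsT, hγ0 _ x (hηT x hx)]
    have hcl := heq.closure (hγc s x)
      ((hγc (ε / 2) x).comp (continuous_const.mul continuous_id))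
    rw [closure_Ioo (by norm_num)] at hcl
    have := hcl h1
    simp only [mul_one] at this
    rw [← this]
    exact (IccExtend_of_mem _ _ h1).symm
  have hO : Ioo (-(ε / 2)) (ε / 2) ×ˢ Metric.ball x₀ ε ⊆ T := fun q hq =>
    hmem q.1 q.2 (by have := abs_lt.2 hq.1; linarith) hq.2
  refine ⟨Ioo (-(ε / 2)) (ε / 2) ×ˢ Metric.ball x₀ ε, φ, isOpen_Ioo.prod Metric.isOpen_ball,
    ⟨⟨by linarith, hη⟩, Metric.mem_ball_self hε⟩, ?_, ?_, ?_⟩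
  · have hev : ContDiff ℝ (⊤ : ℕ∞) (ContinuousMap.evalCLM (M := E) ℝ (⟨1, h1⟩ : Icc (-1 : ℝ) 1)) :=
      ContinuousLinearMap.contDiff _
    exact hev.comp_contDiffOn (hΓ.mono hO)
  · intro x hx
    have := congrArg (fun u : C(Icc (-1 : ℝ) 1, E) => u ⟨1, h1⟩) (hΓe _ (hO hx))
    simpa using this
  · rintro ⟨s, x⟩ ⟨hs, hx⟩
    have hs' : |s| < ε / 2 := abs_lt.2 hs
    have hlt : s / (ε / 2) ∈ Ioo (-1 : ℝ) 1 := by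
      rw [mem_Ioo, ← abs_lt, abs_div, abs_of_pos hη]
      exact (div_lt_one hη).2 hs'
    have := (hγ _ x (hηT x hx) _ hlt).scomp s ((hasDerivAt_id s).div_const (ε / 2))
    have h2 : HasDerivAt (fun s => γ (ε / 2) x (s / (ε / 2))) (f (φ (s, x))) s := by
      rw [smul_smul, one_div, inv_mul_cancel₀ hη.ne', one_smul] at this
      rwa [hφ s x hs' hx]
    refine h2.congr_of_eventuallyEq ?_
    filter_upwards [Ioo_mem_nhds hs.1 hs.2] with σ hσ
    exact hφ σ x (abs_lt.2 hσ) hx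

/-- A field that is smooth on an open set agrees near a given point of it with a smooth field of
compact support. -/
theorem exists_contDiff_hasCompactSupport_eventuallyEq {E F : Type*} [NormedAddCommGroup E]
    [NormedSpace ℝ E] [FiniteDimensional ℝ E] [NormedAddCommGroup F] [NormedSpace ℝ F]
    {f : E → F} {U : Set E} (hU : IsOpen U) (hf : ContDiffOn ℝ (⊤ : ℕ∞) f U) {p : E}
    (hp : p ∈ U) :
    ∃ f' : E → F, ContDiff ℝ (⊤ : ℕ∞) f' ∧ HasCompactSupport f' ∧ f' =ᶠ[nhds p] f := by
  obtain ⟨r, hr, hrU⟩ := Metric.nhds_basis_closedBall.mem_iff.1 (hU.mem_nhds hp)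
  let b : ContDiffBump p := ⟨r / 2, r, by positivity, by linarith⟩
  refine ⟨fun x => b x • f x, contDiff_iff_contDiffAt.2 fun x => ?_, b.hasCompactSupport.smul_right,
    ?_⟩
  · by_cases hx : x ∈ U
    · exact b.contDiff.contDiffAt.smul (hf.contDiffAt (hU.mem_nhds hx))
    · have hx' : x ∈ (tsupport b)ᶜ := fun h => hx (hrU (b.tsupport_eq ▸ h))
      refine (contDiffAt_const (c := (0 : F))).congr_of_eventuallyEq ?_
      filter_upwards [(isClosed_tsupport b).isOpen_compl.mem_nhds hx'] with y hy
      rw [image_eq_zero_of_notMem_tsupport hy, zero_smul]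
  · filter_upwards [b.eventuallyEq_one] with x hx
    rw [hx, Pi.one_apply, one_smul]

theorem two_le_infty : (2 : WithTop ℕ∞) ≤ ((⊤ : ℕ∞) : WithTop ℕ∞) :=
  WithTop.coe_le_coe.2 (le_top : (2 : ℕ∞) ≤ ⊤)

/-- The derivative of the coefficients of the metric in the direction `a`. -/
def metDeriv {n : ℕ} (g : Met n) (a : Pt n) : Met n :=
  fun x i j => fderiv ℝ (fun y => g y i j) x a

/-- The inner product with a fixed vector, as a linear form. -/
def minnerRight {n : ℕ} (g : Met n) (x v : Pt n) : Pt n →ₗ[ℝ] ℝ where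
  toFun := minner g x v
  map_add' := fun w w' => by simp [minner, mul_add, Finset.sum_add_distrib]
  map_smul' := fun c w => by simp [minner, Finset.mul_sum, mul_left_comm]

theorem minner_comm {n : ℕ} {g : Met n} (hg : ∀ x i j, g x i j = g x j i) (x v w : Pt n) :
    minner g x v w = minner g x w v := by
  unfold minner
  rw [Finset.sum_comm]
  refine Finset.sum_congr rfl fun i _ => Finset.sum_congr rfl fun j _ => ?_
  rw [hg x j i]
  ring

theorem metDeriv_symm {n : ℕ} {g : Met n} (hg : ∀ x i j, g x i j = g x j i) (a x : Pt n)
    (i j : Fin n) : metDeriv g a x i j = metDeriv g a x j i := by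
  unfold metDeriv
  simp only [hg _ i j]

theorem minner_add_left {n : ℕ} (g : Met n) (x v v' w : Pt n) :
    minner g x (v + v') w = minner g x v w + minner g x v' w := by
  simp [minner, mul_add, add_mul, Finset.sum_add_distrib]

theorem eq_zero_of_forall_stdb {n m : ℕ} {g : Met n} {x C : Pt n} (L : Pt m →L[ℝ] Pt n)
    (hL : Function.Surjective L) (hpos : ∀ v : Pt n, v ≠ 0 → 0 < minner g x v v)
    (h : ∀ i, minner g x C (L (stdb m i)) = 0) : C = 0 := by
  have h0 : minnerRight g x C ∘ₗ (L : Pt m →ₗ[ℝ] Pt n) = 0 := by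
    refine LinearMap.pi_ext' fun i => LinearMap.ext_ring ?_
    exact h i
  obtain ⟨v, hv⟩ := hL C
  by_contra hC
  have h1 : minner g x C (L v) = 0 := LinearMap.congr_fun h0 v
  rw [hv] at h1
  exact (hpos C hC).ne' h1

theorem isUnit_det_of_pos {n : ℕ} {g : Met n} {x : Pt n}
    (hpos : ∀ v : Pt n, v ≠ 0 → 0 < minner g x v v) : IsUnit (Matrix.of (g x)).det := by
  rw [isUnit_iff_ne_zero]
  intro h
  obtain ⟨v, hv, hgv⟩ := Matrix.exists_mulVec_eq_zero_iff.2 h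
  refine (hpos v hv).ne' ?_
  have : minner g x v v = ∑ i, v i * (Matrix.of (g x)).mulVec v i := by
    simp only [minner, Matrix.mulVec, dotProduct, Matrix.of_apply, Finset.mul_sum]
    exact Finset.sum_congr rfl fun i _ => Finset.sum_congr rfl fun j _ => by ring
  rw [this, hgv]
  simp

/-- Lowering the upper index of the Christoffel symbols. -/
theorem sum_mul_christoffel {n : ℕ} {g : Met n} (hg : ∀ x i j, g x i j = g x j i) {x : Pt n}
    (hpos : ∀ v : Pt n, v ≠ 0 → 0 < minner g x v v) (l i j : Fin n) :
    ∑ k, g x k l * christoffel g x k i j = (1 / 2) *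
      (metDeriv g (stdb n i) x j l + metDeriv g (stdb n j) x i l
        - metDeriv g (stdb n l) x i j) := by
  set B : Fin n → ℝ := fun m => metDeriv g (stdb n i) x j m + metDeriv g (stdb n j) x i m
        - metDeriv g (stdb n m) x i j with hB
  have h1 : ∀ m, ∑ k, g x l k * ginv g x k m = if l = m then 1 else 0 := fun m => by
    have := congrFun (congrFun (Matrix.mul_nonsing_inv _ (isUnit_det_of_pos hpos)) l) m
    rw [Matrix.mul_apply, Matrix.one_apply] at this
    exact this
  calc ∑ k, g x k l * christoffel g x k i j
      = ∑ k, ∑ m, (1 / 2) * B m * (g x l k * ginv g x k m) := by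
        refine Finset.sum_congr rfl fun k _ => ?_
        unfold christoffel
        rw [Finset.mul_sum, Finset.mul_sum, hg x k l]
        refine Finset.sum_congr rfl fun m _ => ?_
        simp only [hB, metDeriv]
        ring
    _ = ∑ m, (1 / 2) * B m * ∑ k, g x l k * ginv g x k m := by
        rw [Finset.sum_comm]
        exact Finset.sum_congr rfl fun m _ => by rw [Finset.mul_sum]
    _ = (1 / 2) * B l := by simp [h1]

theorem metDeriv_eq_sum {n : ℕ} (g : Met n) (a x : Pt n) (i j : Fin n) :
    metDeriv g a x i j = ∑ l, a l * metDeriv g (stdb n l) x i j := by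
  unfold metDeriv
  conv_lhs => rw [pi_eq_sum_univ' a, map_sum]
  refine Finset.sum_congr rfl fun l _ => ?_
  rw [map_smul, smul_eq_mul]
  congr 2

/-- The Koszul formula for the covariant derivative in coordinates. -/
theorem minner_covD {n : ℕ} {g : Met n} (hg : ∀ x i j, g x i j = g x j i) {x : Pt n}
    (hpos : ∀ v : Pt n, v ≠ 0 → 0 < minner g x v v) {Y : Pt n → Pt n}
    (hY : DifferentiableAt ℝ Y x) (v w : Pt n) :
    minner g x (covD g Y x v) w = minner g x (fderiv ℝ Y x v) w +
      (1 / 2) * (minner (metDeriv g v) x (Y x) w + minner (metDeriv g (Y x)) x v w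
        - minner (metDeriv g w) x v (Y x)) := by
  have hsplit : covD g Y x v = fderiv ℝ Y x v +
      fun k => ∑ i, ∑ j, christoffel g x k i j * v i * Y x j := by
    ext k
    simp only [covD, Pi.add_apply]
    rw [fderiv_apply hY]
    rfl
  rw [hsplit, minner_add_left]
  congr 1
  have hL : minner g x (fun k => ∑ i, ∑ j, christoffel g x k i j * v i * Y x j) w =
      ∑ i, ∑ j, ∑ l, (∑ k, g x k l * christoffel g x k i j) * (v i * Y x j * w l) := by
    simp only [minner, Finset.mul_sum, Finset.sum_mul]
    rw [Finset.sum_comm]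
    have hlast : ∀ i : Fin n, ∑ j, ∑ l, ∑ k, g x k l * christoffel g x k i j * (v i * Y x j * w l)
        = ∑ l, ∑ k, ∑ j, g x k l * christoffel g x k i j * (v i * Y x j * w l) := fun i => by
      rw [Finset.sum_comm]
      exact Finset.sum_congr rfl fun l _ => Finset.sum_comm
    simp only [hlast]
    rw [Finset.sum_comm (γ := Fin n) (s := Finset.univ) (t := Finset.univ)
      (f := fun i l => ∑ k, ∑ j, g x k l * christoffel g x k i j * (v i * Y x j * w l))]
    refine Finset.sum_congr rfl fun l _ => ?_
    rw [Finset.sum_comm (γ := Fin n) (s := Finset.univ) (t := Finset.univ)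
      (f := fun i k => ∑ j, g x k l * christoffel g x k i j * (v i * Y x j * w l))]
    refine Finset.sum_congr rfl fun k _ => Finset.sum_congr rfl fun i _ =>
      Finset.sum_congr rfl fun j _ => by ring
  have h1 : minner (metDeriv g v) x (Y x) w =
      ∑ i, ∑ j, ∑ l, metDeriv g (stdb n i) x j l * (v i * Y x j * w l) := by
    simp only [minner, metDeriv_eq_sum g v, Finset.sum_mul]
    rw [Finset.sum_comm' (t' := Finset.univ) (s' := fun _ => Finset.univ) (by simp)]
    have : ∀ j : Fin n, ∑ l, ∑ i, v i * metDeriv g (stdb n i) x j l * Y x j * w l =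
      ∑ i, ∑ l, v i * metDeriv g (stdb n i) x j l * Y x j * w l := fun j => Finset.sum_comm
    rw [Finset.sum_comm]
    simp only [this]
    rw [Finset.sum_comm]
    exact Finset.sum_congr rfl fun k _ => Finset.sum_congr rfl fun i _ =>
      Finset.sum_congr rfl fun j _ => by ring
  have h2 : minner (metDeriv g (Y x)) x v w =
      ∑ i, ∑ j, ∑ l, metDeriv g (stdb n j) x i l * (v i * Y x j * w l) := by
    simp only [minner, metDeriv_eq_sum g (Y x), Finset.sum_mul]
    refine Finset.sum_congr rfl fun i _ => ?_
    rw [Finset.sum_comm]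
    exact Finset.sum_congr rfl fun j _ => Finset.sum_congr rfl fun l _ => by ring
  have h3 : minner (metDeriv g w) x v (Y x) =
      ∑ i, ∑ j, ∑ l, metDeriv g (stdb n l) x i j * (v i * Y x j * w l) := by
    simp only [minner, metDeriv_eq_sum g w, Finset.sum_mul]
    exact Finset.sum_congr rfl fun k _ => Finset.sum_congr rfl fun i _ =>
      Finset.sum_congr rfl fun j _ => by ring
  rw [hL, h1, h2, h3, ← Finset.sum_add_distrib, ← Finset.sum_sub_distrib, Finset.mul_sum]
  refine Finset.sum_congr rfl fun i _ => ?_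
  rw [← Finset.sum_add_distrib, ← Finset.sum_sub_distrib, Finset.mul_sum]
  refine Finset.sum_congr rfl fun j _ => ?_
  rw [← Finset.sum_add_distrib, ← Finset.sum_sub_distrib, Finset.mul_sum]
  refine Finset.sum_congr rfl fun l _ => ?_
  rw [sum_mul_christoffel hg hpos]
  ring

/-- The Killing equation in coordinates: the Lie derivative of the metric vanishes. -/
theorem IsKillingOn.lie_metric_eq_zero {n : ℕ} {U : Set (Pt n)} {g : Met n}
    (hg : IsMetricOn U g) {ξ : Pt n → Pt n} (hξk : IsKillingOn U g ξ) {x : Pt n} (hx : x ∈ U)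
    (hξ : DifferentiableAt ℝ ξ x) (v w : Pt n) :
    minner (metDeriv g (ξ x)) x v w + minner g x (fderiv ℝ ξ x v) w
      + minner g x v (fderiv ℝ ξ x w) = 0 := by
  have h := hξk x hx v w
  rw [minner_covD hg.2.1 (hg.2.2 x hx) hξ, minner_covD hg.2.1 (hg.2.2 x hx) hξ] at h
  rw [minner_comm hg.2.1 x v]
  rw [minner_comm (metDeriv_symm hg.2.1 v) x w, minner_comm (metDeriv_symm hg.2.1 w) x _ v,
    minner_comm (metDeriv_symm hg.2.1 (ξ x)) x w v] at h
  linarith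

theorem hasDerivAt_minner {n : ℕ} {g : Met n} {c A B : ℝ → Pt n} {c' A' B' : Pt n} {t : ℝ}
    (hg : ∀ i j, DifferentiableAt ℝ (fun x => g x i j) (c t))
    (hc : HasDerivAt c c' t) (hA : HasDerivAt A A' t) (hB : HasDerivAt B B' t) :
    HasDerivAt (fun s => minner g (c s) (A s) (B s))
      (minner (metDeriv g c') (c t) (A t) (B t) + minner g (c t) A' (B t)
        + minner g (c t) (A t) B') t := by
  have hA' := hasDerivAt_pi.1 hA
  have hB' := hasDerivAt_pi.1 hB
  have h : HasDerivAt (fun s => minner g (c s) (A s) (B s))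
      (∑ i, ∑ j, ((metDeriv g c' (c t) i j * A t i + g (c t) i j * A' i) * B t j
        + g (c t) i j * A t i * B' j)) t :=
    HasDerivAt.fun_sum fun i _ => HasDerivAt.fun_sum fun j _ =>
      (((hg i j).hasFDerivAt.comp_hasDerivAt t hc).fun_mul (hA' i)).fun_mul (hB' j)
  convert h using 1
  simp only [minner, ← Finset.sum_add_distrib]
  exact Finset.sum_congr rfl fun i _ => Finset.sum_congr rfl fun j _ => by ring

theorem hasDerivAt_pullMet {n : ℕ} {g : Met n} {Φ : Pt n → Pt n} {w : ℝ → Pt n} {w' : Pt n}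
    {t : ℝ} (hg : ∀ i j, DifferentiableAt ℝ (fun x => g x i j) (Φ (w t)))
    (hΦ : ContDiffAt ℝ (⊤ : ℕ∞) Φ (w t)) (hw : HasDerivAt w w' t) (i j : Fin n) :
    HasDerivAt (fun s => pullMet g Φ (w s) i j)
      (minner (metDeriv g (fderiv ℝ Φ (w t) w')) (Φ (w t)) (fderiv ℝ Φ (w t) (stdb n i))
          (fderiv ℝ Φ (w t) (stdb n j))
        + minner g (Φ (w t)) (fderiv ℝ (fderiv ℝ Φ) (w t) (stdb n i) w')
          (fderiv ℝ Φ (w t) (stdb n j))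
        + minner g (Φ (w t)) (fderiv ℝ Φ (w t) (stdb n i))
          (fderiv ℝ (fderiv ℝ Φ) (w t) (stdb n j) w')) t := by
  have hsymm : IsSymmSndFDerivAt ℝ Φ (w t) := hΦ.isSymmSndFDerivAt (by simpa using two_le_infty)
  have hd : DifferentiableAt ℝ (fderiv ℝ Φ) (w t) :=
    (hΦ.fderiv_right (m := 1)
      (by simpa [one_add_one_eq_two] using two_le_infty)).differentiableAt (by simp)
  have h1 : HasDerivAt (fun s => Φ (w s)) (fderiv ℝ Φ (w t) w') t :=
    (hΦ.differentiableAt (by simp)).hasFDerivAt.comp_hasDerivAt t hw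
  have h2 : ∀ k, HasDerivAt (fun s => fderiv ℝ Φ (w s) (stdb n k))
      (fderiv ℝ (fderiv ℝ Φ) (w t) (stdb n k) w') t := fun k => by
    rw [hsymm (stdb n k) w']
    simpa using (hd.hasFDerivAt.comp_hasDerivAt t hw).clm_apply (hasDerivAt_const t (stdb n k))
  exact hasDerivAt_minner hg h1 (h2 i) (h2 j)

/-- The point of `ℝⁿ⁺¹` with base point `u` and height `t`. -/
def extPt {n : ℕ} (u : Pt n) (t : ℝ) : Pt (n + 1) := Fin.snoc (α := fun _ => ℝ) u t

@[simp]
theorem extPt_last {n : ℕ} (u : Pt n) (t : ℝ) : extPt u t (Fin.last n) = t := by simp [extPt]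

@[simp]
theorem extPt_castSucc {n : ℕ} (u : Pt n) (t : ℝ) (i : Fin n) : extPt u t i.castSucc = u i := by
  simp [extPt]

@[simp]
theorem projBase_extPt {n : ℕ} (u : Pt n) (t : ℝ) : projBase (extPt u t) = u := by
  ext i
  simp [projBase]

theorem extPt_projBase {n : ℕ} (w : Pt (n + 1)) : extPt (projBase w) (w (Fin.last n)) = w := by
  ext i
  induction i using Fin.lastCases <;> simp [projBase]

theorem mem_prodDom {n : ℕ} {V : Set (Pt n)} {I : Set ℝ} {u : Pt n} {t : ℝ} :
    extPt u t ∈ prodDom V I ↔ u ∈ V ∧ t ∈ I := by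
  simp [prodDom]

theorem contDiff_projBase {n : ℕ} : ContDiff ℝ (⊤ : ℕ∞) (projBase : Pt (n + 1) → Pt n) :=
  contDiff_pi.2 fun i => contDiff_apply ℝ ℝ i.castSucc

theorem isOpen_prodDom {n : ℕ} {V : Set (Pt n)} {I : Set ℝ} (hV : IsOpen V) (hI : IsOpen I) :
    IsOpen (prodDom V I) :=
  (hV.preimage contDiff_projBase.continuous).inter (hI.preimage (continuous_apply _))

theorem contDiff_extPt {n : ℕ} (t : ℝ) : ContDiff ℝ (⊤ : ℕ∞) fun u : Pt n => extPt u t := by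
  refine contDiff_pi.2 fun i => ?_
  induction i using Fin.lastCases with
  | last => simpa using contDiff_const
  | cast i => simpa using contDiff_apply ℝ ℝ i

theorem hasDerivAt_extPt {n : ℕ} (u : Pt n) (t : ℝ) :
    HasDerivAt (extPt u) (stdb (n + 1) (Fin.last n)) t := by
  refine hasDerivAt_pi.2 fun i => ?_
  induction i using Fin.lastCases with
  | last => simpa [stdb] using hasDerivAt_id' t
  | cast i => simpa [stdb, Fin.castSucc_ne_last] using hasDerivAt_const t (u i)

theorem fderiv_extPt {n : ℕ} (u : Pt n) (t : ℝ) (a : Fin n) :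
    fderiv ℝ (fun v : Pt n => extPt v t) u (stdb n a) = stdb (n + 1) a.castSucc := by
  have hd := (contDiff_extPt (n := n) t).differentiable (by simp) u
  ext i
  have hi := DFunLike.congr_fun (fderiv_apply hd i) (stdb n a)
  rw [ContinuousLinearMap.comp_apply, ContinuousLinearMap.proj_apply] at hi
  rw [← hi]
  induction i using Fin.lastCases with
  | last => simp [stdb, Fin.castSucc_ne_last]
  | cast i =>
    simp only [extPt_castSucc]
    rw [(hasFDerivAt_apply (𝕜 := ℝ) i u).fderiv]
    simp [stdb, Pi.single_apply, Fin.ext_iff]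

theorem fderiv_comp_extPt {n m : ℕ} {Φ : Pt (n + 1) → Pt m} {u : Pt n} {t : ℝ}
    (hΦ : DifferentiableAt ℝ Φ (extPt u t)) (a : Fin n) :
    fderiv ℝ (fun v => Φ (extPt v t)) u (stdb n a)
      = fderiv ℝ Φ (extPt u t) (stdb (n + 1) a.castSucc) := by
  have := fderiv_comp u (f := fun v : Pt n => extPt v t) hΦ
    ((contDiff_extPt (n := n) t).differentiable (by simp) u)
  rw [← fderiv_extPt u t]
  exact DFunLike.congr_fun this _

/-- If `ξ` is the image of the last coordinate field under `Φ`, the second derivatives of `Φ`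
involving the last coordinate are derivatives of `ξ`. -/
theorem fderiv_fderiv_last {n : ℕ} {Φ ξ : Pt (n + 1) → Pt (n + 1)} {w : Pt (n + 1)}
    (hΦ : ContDiffAt ℝ (⊤ : ℕ∞) Φ w) (hξ : DifferentiableAt ℝ ξ (Φ w))
    (h : ∀ᶠ y in nhds w, fderiv ℝ Φ y (stdb (n + 1) (Fin.last n)) = ξ (Φ y)) (v : Pt (n + 1)) :
    fderiv ℝ (fderiv ℝ Φ) w v (stdb (n + 1) (Fin.last n)) = fderiv ℝ ξ (Φ w) (fderiv ℝ Φ w v) := by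
  have hd : DifferentiableAt ℝ (fderiv ℝ Φ) w :=
    (hΦ.fderiv_right (m := 1)
      (by simpa [one_add_one_eq_two] using two_le_infty)).differentiableAt (by simp)
  have h1 : HasFDerivAt (fun y => fderiv ℝ Φ y (stdb (n + 1) (Fin.last n)))
      ((fderiv ℝ ξ (Φ w)).comp (fderiv ℝ Φ w)) w :=
    (hξ.hasFDerivAt.comp w (hΦ.differentiableAt (by simp)).hasFDerivAt).congr_of_eventuallyEq h
  have h2 := hd.hasFDerivAt.clm_apply (hasFDerivAt_const (stdb (n + 1) (Fin.last n)) w)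
  simpa using DFunLike.congr_fun (h2.unique h1) v

theorem IsMetricOn.differentiableAt {n : ℕ} {U : Set (Pt n)} {g : Met n} (hg : IsMetricOn U g)
    (hU : IsOpen U) {x : Pt n} (hx : x ∈ U) (i j : Fin n) :
    DifferentiableAt ℝ (fun y => g y i j) x :=
  ((hg.1 i j).contDiffAt (hU.mem_nhds hx)).differentiableAt (by simp)

theorem prodMet_last {n : ℕ} (g₀ : Met n) (w : Pt (n + 1)) (j : Fin (n + 1)) :
    prodMet g₀ w (Fin.last n) j = if j = Fin.last n then 1 else 0 := by
  induction j using Fin.lastCases <;> simp [prodMet, Fin.castSucc_ne_last]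

/-- In a product, a Killing field tangent to the line factor is parallel. -/
theorem covD_eq_zero_of_pullMet {n : ℕ} {U D : Set (Pt (n + 1))} (hU : IsOpen U) (hD : IsOpen D)
    {g : Met (n + 1)} (hg : IsMetricOn U g) {ξ : Pt (n + 1) → Pt (n + 1)}
    (hξs : ContDiffOn ℝ (⊤ : ℕ∞) ξ U) (hξk : IsKillingOn U g ξ) {Φ : Pt (n + 1) → Pt (n + 1)}
    (hΦ : ContDiffOn ℝ (⊤ : ℕ∞) Φ D) (hmaps : MapsTo Φ D U) {g₂ : Met n}
    (hpull : ∀ w ∈ D, ∀ i j, pullMet g Φ w i j = prodMet g₂ w i j)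
    (hξ : ∀ w ∈ D, fderiv ℝ Φ w (stdb (n + 1) (Fin.last n)) = ξ (Φ w)) {w : Pt (n + 1)}
    (hw : w ∈ D) (hsurj : Function.Surjective (fderiv ℝ Φ w)) (i : Fin (n + 1)) :
    covD g ξ (Φ w) (fderiv ℝ Φ w (stdb (n + 1) i)) = 0 := by
  have hx := hmaps hw
  have hΦw : ContDiffAt ℝ (⊤ : ℕ∞) Φ w := hΦ.contDiffAt (hD.mem_nhds hw)
  have hξd : DifferentiableAt ℝ ξ (Φ w) :=
    (hξs.contDiffAt (hU.mem_nhds hx)).differentiableAt (by simp)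
  have hsymm : IsSymmSndFDerivAt ℝ Φ w := hΦw.isSymmSndFDerivAt (by simpa using two_le_infty)
  have key : ∀ i j, minner (metDeriv g (fderiv ℝ Φ w (stdb (n + 1) i))) (Φ w) (ξ (Φ w))
        (fderiv ℝ Φ w (stdb (n + 1) j))
      + minner g (Φ w) (fderiv ℝ ξ (Φ w) (fderiv ℝ Φ w (stdb (n + 1) i)))
        (fderiv ℝ Φ w (stdb (n + 1) j))
      + minner g (Φ w) (ξ (Φ w))
        (fderiv ℝ (fderiv ℝ Φ) w (stdb (n + 1) j) (stdb (n + 1) i)) = 0 := by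
    intro i j
    set γ : ℝ → Pt (n + 1) := fun s => w + s • stdb (n + 1) i with hγ
    have hγd : HasDerivAt γ (stdb (n + 1) i) 0 := by
      have := ((hasDerivAt_id' (0 : ℝ)).smul_const (stdb (n + 1) i)).const_add w
      rwa [one_smul] at this
    have hγ0 : γ 0 = w := by simp [hγ]
    have h1 := hasDerivAt_pullMet (g := g) (Φ := Φ) (t := 0) (w := γ)
      (by rw [hγ0]; exact hg.differentiableAt hU hx) (by rwa [hγ0]) hγd (Fin.last n) j
    have hev : ∀ᶠ s in nhds (0 : ℝ), γ s ∈ D :=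
      hγd.continuousAt.eventually (by rw [hγ0]; exact hD.mem_nhds hw)
    have h2 : HasDerivAt (fun s => pullMet g Φ (γ s) (Fin.last n) j) 0 0 :=
      (hasDerivAt_const (0 : ℝ) (if j = Fin.last n then (1 : ℝ) else 0)).congr_of_eventuallyEq <|
        hev.mono fun s hs => (hpull _ hs _ _).trans (prodMet_last _ _ _)
    have h3 := h1.unique h2
    rw [hγ0, hsymm (stdb _ (Fin.last n)), fderiv_fderiv_last hΦw hξd
      (Filter.eventually_of_mem (hD.mem_nhds hw) hξ), hξ w hw] at h3
    exact h3
  refine eq_zero_of_forall_stdb _ hsurj (hg.2.2 _ hx) fun j => ?_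
  rw [minner_covD hg.2.1 (hg.2.2 _ hx) hξd]
  have h1 := key i j
  have h2 := key j i
  have h3 := hξk.lie_metric_eq_zero hg hx hξd (fderiv ℝ Φ w (stdb (n + 1) i))
    (fderiv ℝ Φ w (stdb (n + 1) j))
  rw [hsymm (stdb _ i), minner_comm (metDeriv_symm hg.2.1 _) _ (ξ (Φ w)) (fderiv ℝ Φ w (stdb _ i)),
    minner_comm hg.2.1 _ _ (fderiv ℝ Φ w (stdb _ i))] at h2
  linarith

theorem injective_fderiv_of_leftInverse {E F : Type*} [NormedAddCommGroup E] [NormedSpace ℝ E]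
    [NormedAddCommGroup F] [NormedSpace ℝ F] {Φ : E → F} {Ψ : F → E} {w : E}
    (hΦ : DifferentiableAt ℝ Φ w) (hΨ : DifferentiableAt ℝ Ψ (Φ w))
    (h : ∀ᶠ y in nhds w, Ψ (Φ y) = y) : Function.Injective (fderiv ℝ Φ w) := by
  have h1 : HasFDerivAt (fun y => Ψ (Φ y)) (ContinuousLinearMap.id ℝ E) w :=
    (hasFDerivAt_id w).congr_of_eventuallyEq h
  have h2 := (hΨ.hasFDerivAt.comp w hΦ.hasFDerivAt).unique h1
  exact Function.LeftInverse.injective (g := fderiv ℝ Ψ (Φ w)) fun v => DFunLike.congr_fun h2 v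

theorem linearIndependent_stdb_castSucc (n : ℕ) :
    LinearIndependent ℝ fun a : Fin n => stdb (n + 1) a.castSucc := by
  have := (Pi.basisFun ℝ (Fin (n + 1))).linearIndependent.comp Fin.castSucc
    (Fin.castSucc_injective n)
  convert this using 2 with a
  simp [stdb]

/-- The slices of a product are totally geodesic and orthogonal to the line factor. -/
theorem exists_totallyGeodesic_of_product {n : ℕ} {U : Set (Pt (n + 1))} (hU : IsOpen U)
    {g : Met (n + 1)} (hg : IsMetricOn U g) {ξ : Pt (n + 1) → Pt (n + 1)}
    (hξs : ContDiffOn ℝ (⊤ : ℕ∞) ξ U) (hξu : IsUnitOn U g ξ) (hξk : IsKillingOn U g ξ)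
    {p : Pt (n + 1)} {V₀ : Set (Pt n)} {Iv : Set ℝ} {g₂ : Met n} {Φ Ψ : Pt (n + 1) → Pt (n + 1)}
    (hV : IsOpen V₀) (hI : IsOpen Iv) (hΦ : ContDiffOn ℝ (⊤ : ℕ∞) Φ (prodDom V₀ Iv))
    (hmaps : MapsTo Φ (prodDom V₀ Iv) U) (himage : IsOpen (Φ '' prodDom V₀ Iv))
    (hp : p ∈ Φ '' prodDom V₀ Iv) (hΨ : ContDiffOn ℝ (⊤ : ℕ∞) Ψ (Φ '' prodDom V₀ Iv))
    (hinv : ∀ w ∈ prodDom V₀ Iv, Ψ (Φ w) = w)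
    (hpull : ∀ w ∈ prodDom V₀ Iv, ∀ i j, pullMet g Φ w i j = prodMet g₂ w i j)
    (hξ : ∀ w ∈ prodDom V₀ Iv, fderiv ℝ Φ w (stdb (n + 1) (Fin.last n)) = ξ (Φ w)) :
    ∃ S : Hyp n, S.IsRegular U g ∧ S.TotallyGeodesic g ∧ (∃ u ∈ S.V, S.F u = p) ∧
      ∀ u ∈ S.V, ∀ a : Fin n,
        minner g (S.F u) (ξ (S.F u)) (fderiv ℝ S.F u (stdb n a)) = 0 := by
  obtain ⟨w₀, hw₀, rfl⟩ := hp
  have hD := isOpen_prodDom hV hI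
  have hmem : ∀ u ∈ V₀, extPt u (w₀ (Fin.last n)) ∈ prodDom V₀ Iv := fun u hu =>
    mem_prodDom.2 ⟨hu, hw₀.2⟩
  have hΦd : ∀ w ∈ prodDom V₀ Iv, DifferentiableAt ℝ Φ w := fun w hw =>
    (hΦ.contDiffAt (hD.mem_nhds hw)).differentiableAt (by simp)
  have hinj : ∀ w ∈ prodDom V₀ Iv, Function.Injective (fderiv ℝ Φ w) := fun w hw =>
    injective_fderiv_of_leftInverse (hΦd w hw)
      ((hΨ.contDiffAt (himage.mem_nhds (mem_image_of_mem Φ hw))).differentiableAt (by simp))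
      (Filter.eventually_of_mem (hD.mem_nhds hw) hinv)
  have hF : ∀ u ∈ V₀, ∀ a : Fin n, fderiv ℝ (fun v => Φ (extPt v (w₀ (Fin.last n)))) u (stdb n a)
      = fderiv ℝ Φ (extPt u (w₀ (Fin.last n))) (stdb (n + 1) a.castSucc) := fun u hu a =>
    fderiv_comp_extPt (hΦd _ (hmem u hu)) a
  have hFs : ContDiffOn ℝ (⊤ : ℕ∞) (fun v => Φ (extPt v (w₀ (Fin.last n)))) V₀ :=
    hΦ.comp (contDiff_extPt _).contDiffOn hmem
  have horth : ∀ u ∈ V₀, ∀ a : Fin n, minner g (Φ (extPt u (w₀ (Fin.last n))))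
      (ξ (Φ (extPt u (w₀ (Fin.last n)))))
      (fderiv ℝ (fun v => Φ (extPt v (w₀ (Fin.last n)))) u (stdb n a)) = 0 := fun u hu a => by
    have := hpull _ (hmem u hu) (Fin.last n) a.castSucc
    rw [prodMet_last, if_neg (Fin.castSucc_ne_last a)] at this
    rw [hF u hu, ← hξ _ (hmem u hu)]
    exact this
  refine ⟨⟨V₀, fun u => Φ (extPt u (w₀ (Fin.last n))), fun u => ξ (Φ (extPt u (w₀ (Fin.last n))))⟩,
    ⟨hV, hFs, fun u hu => hmaps (hmem u hu), fun u hu => ?_,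
      hξs.comp hFs fun u hu => hmaps (hmem u hu), fun u hu => hξu _ (hmaps (hmem u hu)), horth⟩,
    fun u hu a => ?_, ⟨projBase w₀, hw₀.1, ?_⟩, horth⟩
  · simp only [hF u hu]
    exact (linearIndependent_stdb_castSucc n).map_injOn
      (fderiv ℝ Φ (extPt u (w₀ (Fin.last n)))).toLinearMap (hinj _ (hmem u hu)).injOn
  · have hx := hmaps (hmem u hu)
    have hξd : DifferentiableAt ℝ ξ (Φ (extPt u (w₀ (Fin.last n)))) :=
      (hξs.contDiffAt (hU.mem_nhds hx)).differentiableAt (by simp)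
    have hFd : DifferentiableAt ℝ (fun v => Φ (extPt v (w₀ (Fin.last n)))) u :=
      (hFs.contDiffAt (hV.mem_nhds hu)).differentiableAt (by simp)
    have h := covD_eq_zero_of_pullMet hU hD hg hξs hξk hΦ hmaps hpull hξ (hmem u hu)
      (LinearMap.injective_iff_surjective.1 (hinj _ (hmem u hu))) a.castSucc
    rw [← h]
    ext k
    have hk : DifferentiableAt ℝ (fun y => ξ y k) (Φ (extPt u (w₀ (Fin.last n)))) :=
      differentiableAt_pi.1 hξd k
    have hchain := DFunLike.congr_fun (fderiv_comp u hk hFd) (stdb n a)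
    rw [ContinuousLinearMap.comp_apply, hF u hu] at hchain
    simp only [covAlong, covD, hF u hu]
    rw [← hchain]
    rfl
  · simp only [extPt_projBase]

/-- Moving a parametrized hypersurface `F` along the flow of a vector field `ξ`. -/
theorem exists_flow_extension {n : ℕ} {U : Set (Pt (n + 1))} (hU : IsOpen U)
    {ξ : Pt (n + 1) → Pt (n + 1)} (hξs : ContDiffOn ℝ (⊤ : ℕ∞) ξ U) {V : Set (Pt n)}
    (hV : IsOpen V) {F : Pt n → Pt (n + 1)} (hF : ContDiffOn ℝ (⊤ : ℕ∞) F V)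
    {u₀ : Pt n} (hu₀ : u₀ ∈ V) (hFU : F u₀ ∈ U) :
    ∃ (D : Set (Pt (n + 1))) (Φ : Pt (n + 1) → Pt (n + 1)), IsOpen D ∧ extPt u₀ 0 ∈ D ∧
      ContDiffOn ℝ (⊤ : ℕ∞) Φ D ∧ MapsTo Φ D U ∧
      (∀ u, extPt u 0 ∈ D → u ∈ V ∧ Φ (extPt u 0) = F u) ∧
      ∀ w ∈ D, fderiv ℝ Φ w (stdb (n + 1) (Fin.last n)) = ξ (Φ w) := by
  obtain ⟨f, hf, hfc, hfξ⟩ := exists_contDiff_hasCompactSupport_eventuallyEq hU hξs hFU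
  obtain ⟨K, hK⟩ := hf.lipschitzWith_of_hasCompactSupport hfc (by simp)
  obtain ⟨B, hB, hBo, hFB⟩ := eventually_nhds_iff.1 hfξ
  obtain ⟨O, φ, hO, h0, hφ, hφ0, hφd⟩ := exists_contDiffOn_flow hf hK (F u₀)
  set G : Pt (n + 1) → ℝ × Pt (n + 1) := fun w => (w (Fin.last n), F (projBase w)) with hG
  have hGs : ContDiffOn ℝ (⊤ : ℕ∞) G (projBase ⁻¹' V) :=
    (contDiff_apply ℝ ℝ (Fin.last n)).contDiffOn.prodMk
      (hF.comp contDiff_projBase.contDiffOn fun w hw => hw)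
  have hD₁ : IsOpen (projBase ⁻¹' V ∩ G ⁻¹' O) :=
    hGs.continuousOn.isOpen_inter_preimage (hV.preimage contDiff_projBase.continuous) hO
  have hΦ : ContDiffOn ℝ (⊤ : ℕ∞) (fun w => φ (G w)) (projBase ⁻¹' V ∩ G ⁻¹' O) :=
    hφ.comp (hGs.mono inter_subset_left) fun w hw => hw.2
  have hG0 : ∀ u, G (extPt u 0) = (0, F u) := fun u => by simp [hG]
  refine ⟨(projBase ⁻¹' V ∩ G ⁻¹' O) ∩ (fun w => φ (G w)) ⁻¹' (B ∩ U), fun w => φ (G w),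
    hΦ.continuousOn.isOpen_inter_preimage hD₁ (hBo.inter hU), ⟨⟨?_, ?_⟩, ?_⟩,
    hΦ.mono inter_subset_left, fun w hw => hw.2.2, fun u hu => ⟨?_, ?_⟩, fun w hw => ?_⟩
  · simpa using hu₀
  · rw [mem_preimage, hG0]
    exact h0
  · rw [mem_preimage, hG0, hφ0 _ h0]
    exact ⟨hFB, hFU⟩
  · simpa using hu.1.1
  · have := hu.1.2
    rw [mem_preimage, hG0] at this
    simp only [hG0, hφ0 _ this]
  · have hd : DifferentiableAt ℝ (fun w => φ (G w)) w :=
      (hΦ.contDiffAt (hD₁.mem_nhds hw.1)).differentiableAt (by simp)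
    have h1 : HasFDerivAt (fun w => φ (G w)) (fderiv ℝ (fun w => φ (G w)) w)
        (extPt (projBase w) (w (Fin.last n))) := by
      rw [extPt_projBase]
      exact hd.hasFDerivAt
    have h2 := h1.comp_hasDerivAt (w (Fin.last n)) (hasDerivAt_extPt (projBase w) _)
    have h3 := hφd (G w) hw.1.2
    rw [← hB _ hw.2.1]
    refine h2.unique ?_
    convert h3 using 2 with s
    simp [hG]

/-- The flow of a Killing field preserves the metric. -/
theorem pullMet_extPt_eq {n : ℕ} {U D : Set (Pt (n + 1))} (hU : IsOpen U) (hD : IsOpen D)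
    {g : Met (n + 1)} (hg : IsMetricOn U g) {ξ : Pt (n + 1) → Pt (n + 1)}
    (hξs : ContDiffOn ℝ (⊤ : ℕ∞) ξ U) (hξk : IsKillingOn U g ξ) {Φ : Pt (n + 1) → Pt (n + 1)}
    (hΦ : ContDiffOn ℝ (⊤ : ℕ∞) Φ D) (hmaps : MapsTo Φ D U)
    (hξ : ∀ w ∈ D, fderiv ℝ Φ w (stdb (n + 1) (Fin.last n)) = ξ (Φ w)) {u : Pt n} {I : Set ℝ}
    (hI : IsOpen I) (hIc : IsPreconnected I) (hID : ∀ t ∈ I, extPt u t ∈ D) {s t : ℝ}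
    (hs : s ∈ I) (ht : t ∈ I) (i j : Fin (n + 1)) :
    pullMet g Φ (extPt u t) i j = pullMet g Φ (extPt u s) i j := by
  have key : ∀ r ∈ I, HasDerivAt (fun r => pullMet g Φ (extPt u r) i j) 0 r := by
    intro r hr
    have hw := hID r hr
    have hx := hmaps hw
    have hΦw : ContDiffAt ℝ (⊤ : ℕ∞) Φ (extPt u r) := hΦ.contDiffAt (hD.mem_nhds hw)
    have hξd : DifferentiableAt ℝ ξ (Φ (extPt u r)) :=
      (hξs.contDiffAt (hU.mem_nhds hx)).differentiableAt (by simp)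
    convert hasDerivAt_pullMet (hg.differentiableAt hU hx) hΦw (hasDerivAt_extPt u r) i j using 1
    have h2 := fderiv_fderiv_last hΦw hξd (Filter.eventually_of_mem (hD.mem_nhds hw) hξ)
    rw [h2, h2, hξ _ hw]
    exact (hξk.lie_metric_eq_zero hg hx hξd _ _).symm
  exact hI.is_const_of_deriv_eq_zero hIc
    (fun r hr => (key r hr).differentiableAt.differentiableWithinAt)
    (fun r hr => (key r hr).deriv) ht hs

theorem injective_of_orthogonal {n : ℕ} {g : Met (n + 1)} {x : Pt (n + 1)}
    {L : Pt (n + 1) →L[ℝ] Pt (n + 1)}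
    (h1 : minner g x (L (stdb (n + 1) (Fin.last n))) (L (stdb (n + 1) (Fin.last n))) = 1)
    (h0 : ∀ a : Fin n,
      minner g x (L (stdb (n + 1) (Fin.last n))) (L (stdb (n + 1) a.castSucc)) = 0)
    (hL : LinearIndependent ℝ fun a : Fin n => L (stdb (n + 1) a.castSucc)) :
    Function.Injective L := by
  refine (injective_iff_map_eq_zero L).2 fun v hv => ?_
  have hsum : ∑ a : Fin n, v a.castSucc • L (stdb (n + 1) a.castSucc)
      + v (Fin.last n) • L (stdb (n + 1) (Fin.last n)) = 0 := by
    rw [← hv]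
    conv_rhs => rw [pi_eq_sum_univ' v, map_sum, Fin.sum_univ_castSucc]
    simp only [map_smul]
    rfl
  have hlast : v (Fin.last n) = 0 := by
    have := congrArg (minnerRight g x (L (stdb (n + 1) (Fin.last n)))) hsum
    rw [map_add, map_sum, map_smul, map_zero, Finset.sum_eq_zero fun a _ => by
      rw [map_smul]; exact (congrArg _ (h0 a)).trans (smul_zero _), zero_add] at this
    have h1' : minnerRight g x (L (stdb (n + 1) (Fin.last n))) (L (stdb (n + 1) (Fin.last n))) = 1 :=
      h1
    rwa [h1', smul_eq_mul, mul_one] at this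
  rw [hlast, zero_smul, add_zero] at hsum
  ext i
  induction i using Fin.lastCases with
  | last => exact hlast
  | cast a => exact Fintype.linearIndependent_iff.1 hL _ hsum a

/-- A hypersurface orthogonal to a unit Killing field spreads out to a local product
structure under its flow. -/
theorem exists_product_of_orthogonal {n : ℕ} {U : Set (Pt (n + 1))} (hU : IsOpen U)
    {g : Met (n + 1)} (hg : IsMetricOn U g) {ξ : Pt (n + 1) → Pt (n + 1)}
    (hξs : ContDiffOn ℝ (⊤ : ℕ∞) ξ U) (hξu : IsUnitOn U g ξ) (hξk : IsKillingOn U g ξ)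
    {S : Hyp n} (hS : S.IsRegular U g) {u₀ : Pt n} (hu₀ : u₀ ∈ S.V)
    (horth : ∀ u ∈ S.V, ∀ a : Fin n,
      minner g (S.F u) (ξ (S.F u)) (fderiv ℝ S.F u (stdb n a)) = 0) :
    ∃ (V₀ : Set (Pt n)) (Iv : Set ℝ) (g₂ : Met n) (Φ Ψ : Pt (n + 1) → Pt (n + 1)),
      IsOpen V₀ ∧ IsOpen Iv ∧ Iv.OrdConnected ∧
      ContDiffOn ℝ (⊤ : ℕ∞) Φ (prodDom V₀ Iv) ∧ MapsTo Φ (prodDom V₀ Iv) U ∧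
      IsOpen (Φ '' prodDom V₀ Iv) ∧ S.F u₀ ∈ Φ '' prodDom V₀ Iv ∧
      ContDiffOn ℝ (⊤ : ℕ∞) Ψ (Φ '' prodDom V₀ Iv) ∧
      (∀ w ∈ prodDom V₀ Iv, Ψ (Φ w) = w) ∧
      (∀ w ∈ prodDom V₀ Iv, ∀ i j, pullMet g Φ w i j = prodMet g₂ w i j) ∧
      (∀ w ∈ prodDom V₀ Iv, fderiv ℝ Φ w (stdb (n + 1) (Fin.last n)) = ξ (Φ w)) := by
  obtain ⟨hV, hFs, hFU, hFi, -, -, -⟩ := hS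
  obtain ⟨D, Φ, hD, hD0, hΦ, hmaps, hΦ0, hξ⟩ :=
    exists_flow_extension hU hξs hV hFs hu₀ (hFU u₀ hu₀)
  have hΦd : ∀ w ∈ D, DifferentiableAt ℝ Φ w := fun w hw =>
    (hΦ.contDiffAt (hD.mem_nhds hw)).differentiableAt (by simp)
  have hΦ' : ∀ u, extPt u 0 ∈ D → ∀ a : Fin n,
      fderiv ℝ Φ (extPt u 0) (stdb (n + 1) a.castSucc) = fderiv ℝ S.F u (stdb n a) := by
    intro u hu a
    rw [← fderiv_comp_extPt (hΦd _ hu)]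
    have : (fun v => Φ (extPt v 0)) =ᶠ[nhds u] S.F :=
      ((contDiff_extPt 0).continuous.continuousAt.eventually (hD.mem_nhds hu)).mono
        fun v hv => (hΦ0 v hv).2
    rw [this.fderiv_eq]
  have h1 : ∀ u, extPt u 0 ∈ D → pullMet g Φ (extPt u 0) (Fin.last n) (Fin.last n) = 1 :=
    fun u hu => by
      unfold pullMet
      rw [hξ _ hu]
      exact hξu _ (hmaps hu)
  have h0 : ∀ u, extPt u 0 ∈ D → ∀ a : Fin n,
      pullMet g Φ (extPt u 0) (Fin.last n) a.castSucc = 0 := fun u hu a => by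
    unfold pullMet
    rw [hξ _ hu, hΦ' u hu, (hΦ0 u hu).2]
    exact horth u (hΦ0 u hu).1 a
  have hinj : Function.Injective (fderiv ℝ Φ (extPt u₀ 0)) :=
    injective_of_orthogonal (h1 u₀ hD0) (h0 u₀ hD0) (by simpa only [hΦ' u₀ hD0] using hFi u₀ hu₀)
  obtain ⟨e, he0, heD, heΦ, hes⟩ := exists_openPartialHomeomorph_contDiffOn_symm hD hΦ hD0
    (LinearEquiv.ofInjectiveEndo (fderiv ℝ Φ (extPt u₀ 0)).toLinearMap
      hinj).toContinuousLinearEquiv (hΦd _ hD0).hasFDerivAt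
  obtain ⟨ε, hε, hball⟩ := Metric.isOpen_iff.1 e.open_source _ he0
  have hsub : prodDom (Metric.ball u₀ ε) (Ioo (-ε) ε) ⊆ e.source := by
    intro w hw
    refine hball ((dist_pi_lt_iff hε).2 fun i => ?_)
    induction i using Fin.lastCases with
    | last => simpa [abs_lt] using hw.2
    | cast i => simpa [projBase] using (dist_pi_lt_iff hε).1 hw.1 i
  have heΦ' : Φ = e := (funext heΦ).symm
  have himage : IsOpen (Φ '' prodDom (Metric.ball u₀ ε) (Ioo (-ε) ε)) := by
    rw [heΦ']
    exact e.isOpen_image_of_subset_source (isOpen_prodDom Metric.isOpen_ball isOpen_Ioo) hsub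
  refine ⟨Metric.ball u₀ ε, Ioo (-ε) ε,
    fun u a b => pullMet g Φ (extPt u 0) a.castSucc b.castSucc, Φ, e.symm, Metric.isOpen_ball,
    isOpen_Ioo, ordConnected_Ioo, hΦ.mono (hsub.trans heD), hmaps.mono_left (hsub.trans heD),
    himage, ⟨extPt u₀ 0, ?_, (hΦ0 u₀ hD0).2⟩, hes.mono ?_, fun w hw => ?_, fun w hw i j => ?_,
    fun w hw => hξ w (heD (hsub hw))⟩
  · exact mem_prodDom.2 ⟨Metric.mem_ball_self hε, neg_lt_zero.2 hε, hε⟩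
  · rw [heΦ']
    exact (image_mono hsub).trans e.image_source_eq_target.subset
  · rw [heΦ']
    exact e.left_inv (hsub hw)
  · have h00 : (0 : ℝ) ∈ Ioo (-ε) ε := ⟨neg_lt_zero.2 hε, hε⟩
    have hu : extPt (projBase w) 0 ∈ D := heD (hsub (mem_prodDom.2 ⟨hw.1, h00⟩))
    have := pullMet_extPt_eq hU hD hg hξs hξk hΦ hmaps hξ isOpen_Ioo isPreconnected_Ioo
      (fun t ht => heD (hsub (mem_prodDom.2 ⟨hw.1, ht⟩))) h00 hw.2 i j
    rw [extPt_projBase] at this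
    rw [this]
    have hcomm : ∀ i j, pullMet g Φ (extPt (projBase w) 0) i j
        = pullMet g Φ (extPt (projBase w) 0) j i := fun i j => minner_comm hg.2.1 _ _ _
    induction i using Fin.lastCases with
    | last =>
      induction j using Fin.lastCases with
      | last => simpa [prodMet] using h1 _ hu
      | cast j => simpa [prodMet] using h0 _ hu j
    | cast i =>
      induction j using Fin.lastCases with
      | last => simpa [prodMet] using (hcomm _ _).trans (h0 _ hu i)
      | cast j => simp [prodMet]

/-- Theorem 2 (1).  Let `M` be a Riemannian three-manifold carrying a
unit Killing field `ξ` and `p ∈ M`.  Then `M` admits a totally geodesic surface through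
`p` which is everywhere orthogonal to `ξ` if and only if, in a neighborhood of `p`, `M`
has a Riemannian product structure `Σ × I` of a surface with an interval, with `ξ`
tangent to the factor `I`. -/
theorem statement9 (U : Set (Pt 3)) (hU : IsOpen U)
    (g : Met 3) (hg : IsMetricOn U g)
    (ξ : Pt 3 → Pt 3) (hξs : ContDiffOn ℝ (⊤ : ℕ∞) ξ U)
    (hξu : IsUnitOn U g ξ) (hξk : IsKillingOn U g ξ)
    (p : Pt 3) (hp : p ∈ U) :
    (∃ S : Hyp 2, S.IsRegular U g ∧ S.TotallyGeodesic g ∧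
      (∃ u ∈ S.V, S.F u = p) ∧
      -- the surface is everywhere orthogonal to `ξ`:
      (∀ u ∈ S.V, ∀ a : Fin 2,
        minner g (S.F u) (ξ (S.F u)) (fderiv ℝ S.F u (stdb 2 a)) = 0))
    ↔
    (∃ (V₀ : Set (Pt 2)) (Iv : Set ℝ) (g₂ : Met 2) (Φ Ψ : Pt 3 → Pt 3),
      IsOpen V₀ ∧ IsOpen Iv ∧ Iv.OrdConnected ∧
      -- `Φ` is a diffeomorphism from `V₀ × Iv` onto a neighborhood of `p` in `M`:
      ContDiffOn ℝ (⊤ : ℕ∞) Φ (prodDom V₀ Iv) ∧ MapsTo Φ (prodDom V₀ Iv) U ∧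
      IsOpen (Φ '' prodDom V₀ Iv) ∧ p ∈ Φ '' prodDom V₀ Iv ∧
      ContDiffOn ℝ (⊤ : ℕ∞) Ψ (Φ '' prodDom V₀ Iv) ∧
      (∀ w ∈ prodDom V₀ Iv, Ψ (Φ w) = w) ∧
      -- in these coordinates the metric is the product metric of a surface with an interval:
      (∀ w ∈ prodDom V₀ Iv, ∀ i j : Fin 3, pullMet g Φ w i j = prodMet g₂ w i j) ∧
      -- and `ξ` is tangent to the factor `I`:
      (∀ w ∈ prodDom V₀ Iv, fderiv ℝ Φ w (stdb 3 (Fin.last 2)) = ξ (Φ w))) := by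
  constructor
  · rintro ⟨S, hS, -, ⟨u₀, hu₀, rfl⟩, horth⟩
    exact exists_product_of_orthogonal hU hg hξs hξu hξk hS hu₀ horth
  · rintro ⟨V₀, Iv, g₂, Φ, Ψ, hV, hI, -, hΦ, hmaps, himage, hp', hΨ, hinv, hpull, hξ⟩
    exact exists_totallyGeodesic_of_product hU hg hξs hξu hξk hV hI hΦ hmaps himage hp' hΨ hinv
      hpull hξ
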